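/- Let N be a positive integer, ε > 0, T > 0, and y ∈ ℝ^N. Let u : ℝ^N × (0,T] → ℂ be smooth, solve ∂ₜu = Δu + ε⁻²u(1−|u|²), and be such that u, ∂ₜu, and all first and second spatial derivatives of u are bounded on ℝ^N × [δ,T] for every δ ∈ (0,T). Let K(x,s;y) := (4πs)^{−N/2}exp(−|x−y|²/(4s)) and for 0 < R < √T set Z(R) := R²·∫_{ℝ^N} e_ε(u(x,T−R²))·K(x,R²;y) dx. Then Z is differentiable on (0,√T) and Z′(R) = 2R·∫_{ℝ^N} [V_ε(u(x,T−R²)) + Ξ(x,T−R²)]·K(x,R²;y) dx, where Ξ(x,t) := (T−t)·|∂ₜu(x,t) − ((x−y)·∇)u(x,t)/(2(T−t))|². -/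

import Mathlib

open MeasureTheory

section GLaux
set_option linter.unusedSectionVars false
open Filter Topology Set

variable {E F : Type*} [NormedAddCommGroup E] [NormedSpace ℝ E]
  [NormedAddCommGroup F] [NormedSpace ℝ F]

lemma gl_slice_t {g : ℝ × E → F} {t : ℝ} {x : E} (h : DifferentiableAt ℝ g (t, x)) :
    HasDerivAt (fun s => g (s, x)) (fderiv ℝ g (t, x) (1, 0)) t := by
  have h1 : HasDerivAt (fun s : ℝ => (s, x)) ((1 : ℝ), (0 : E)) t :=
    (hasDerivAt_id t).prodMk (hasDerivAt_const t x)
  exact h.hasFDerivAt.comp_hasDerivAt t h1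

lemma gl_slice_x {g : ℝ × E → F} {t : ℝ} {x : E} (h : DifferentiableAt ℝ g (t, x)) :
    HasFDerivAt (fun z => g (t, z)) ((fderiv ℝ g (t, x)).comp (ContinuousLinearMap.inr ℝ ℝ E)) x :=
  h.hasFDerivAt.comp x (hasFDerivAt_prodMk_right t x)

lemma gl_slice_cont {g : ℝ × E → F} {a b t : ℝ} (ht : t ∈ Ioo a b)
    (h : ContinuousOn g (Ioo a b ×ˢ univ)) : Continuous (fun x => g (t, x)) := by
  rw [← continuousOn_univ]
  exact h.comp (by fun_prop) (fun x _ => ⟨ht, mem_univ _⟩)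

variable [FiniteDimensional ℝ E] [MeasurableSpace E] [BorelSpace E]
  (μ : Measure E) [μ.IsAddHaarMeasure]

lemma gl_param {g : ℝ × E → ℝ} {a b : ℝ}
    (hg : ContDiffOn ℝ 1 g (Ioo a b ×ˢ (univ : Set E))) {ψ : E → ℝ} (hψ : Continuous ψ)
    (hc : HasCompactSupport ψ) {t : ℝ} (ht : t ∈ Ioo a b) :
    HasDerivAt (fun t => ∫ x, ψ x * g (t, x) ∂μ)
      (∫ x, ψ x * fderiv ℝ g (t, x) (1, 0) ∂μ) t := by
  have hO : IsOpen (Ioo a b ×ˢ (univ : Set E)) := isOpen_Ioo.prod isOpen_univ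
  have hd : ContinuousOn (fun p => fderiv ℝ g p (1, 0)) (Ioo a b ×ˢ (univ : Set E)) :=
    (hg.continuousOn_fderiv_of_isOpen hO le_rfl).clm_apply continuousOn_const
  obtain ⟨r, hr, hsub⟩ := Metric.nhds_basis_closedBall.mem_iff.1 (isOpen_Ioo.mem_nhds ht)
  have hcomp : IsCompact (Metric.closedBall t r ×ˢ tsupport ψ) :=
    (isCompact_closedBall t r).prod hc
  obtain ⟨C, hC⟩ := hcomp.exists_bound_of_continuousOn
    (hd.mono (prod_mono hsub (subset_univ _)))
  have hcpt : ∀ {f : E → ℝ}, Continuous f → Integrable (fun x => ψ x * f x) μ := fun hf =>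
    (hψ.mul hf).integrable_of_hasCompactSupport hc.mul_right
  refine (hasDerivAt_integral_of_dominated_loc_of_deriv_le (s := Metric.closedBall t r)
    (bound := fun x => ‖ψ x‖ * C)
    (F' := fun t x => ψ x * fderiv ℝ g (t, x) (1, 0)) (Metric.closedBall_mem_nhds t hr)
    ?_ ?_ ?_ ?_ ?_ ?_).2
  · filter_upwards [isOpen_Ioo.mem_nhds ht] with s hs
    exact (hcpt (gl_slice_cont hs hg.continuousOn)).aestronglyMeasurable
  · exact hcpt (gl_slice_cont ht hg.continuousOn)
  · exact (hcpt (gl_slice_cont ht hd)).aestronglyMeasurable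
  · refine .of_forall fun x s hs => ?_
    rw [norm_mul]
    by_cases hx : x ∈ tsupport ψ
    · exact mul_le_mul_of_nonneg_left (hC (s, x) ⟨hs, hx⟩) (norm_nonneg _)
    · simp [image_eq_zero_of_notMem_tsupport hx]
  · exact (hψ.integrable_of_hasCompactSupport hc).norm.mul_const C
  · refine .of_forall fun x s hs => ?_
    refine (gl_slice_t ?_).const_mul (ψ x)
    exact (hg.contDiffAt (hO.mem_nhds ⟨hsub hs, mem_univ _⟩)).differentiableAt one_ne_zero

lemma gl_cutoff : ∃ (χ : ℕ → E → ℝ) (M : ℝ), 0 ≤ M ∧ (∀ n, ContDiff ℝ 1 (χ n)) ∧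
    (∀ n, HasCompactSupport (χ n)) ∧ (∀ n x, 0 ≤ χ n x ∧ χ n x ≤ 1) ∧
    (∀ x, Tendsto (fun n => χ n x) atTop (𝓝 1)) ∧
    (∀ n x, ‖fderiv ℝ (χ n) x‖ ≤ M * ((n : ℝ) + 1)⁻¹) := by
  let b : ContDiffBump (0 : E) := ⟨1, 2, by norm_num, by norm_num⟩
  have hb : ContDiff ℝ 1 b := b.contDiff
  have hcs : HasCompactSupport b := b.hasCompactSupport
  obtain ⟨M, hM⟩ := (hb.continuous_fderiv one_ne_zero).bounded_above_of_compact_support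
    (hcs.fderiv ℝ)
  have hp : ∀ n : ℕ, (0 : ℝ) < ((n : ℝ) + 1)⁻¹ := fun n => by positivity
  refine ⟨fun n x => b (((n : ℝ) + 1)⁻¹ • x), M, (norm_nonneg _).trans (hM 0), ?_, ?_, ?_, ?_, ?_⟩
  · intro n
    exact hb.comp (contDiff_const_smul _)
  · intro n
    exact hcs.comp_smul (hp n).ne'
  · intro n x
    exact ⟨b.nonneg, b.le_one⟩
  · intro x
    have h0 : Tendsto (fun n : ℕ => ((n : ℝ) + 1)⁻¹ • x) atTop (𝓝 ((0 : ℝ) • x)) := by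
      refine Tendsto.smul_const ?_ x
      simpa using tendsto_one_div_add_atTop_nhds_zero_nat (𝕜 := ℝ)
    have := (hb.continuous.tendsto _).comp h0
    have h1 : b ((0 : ℝ) • x) = 1 := by
      rw [zero_smul]
      exact b.one_of_mem_closedBall (by simp [b])
    rw [h1] at this
    exact this
  · intro n x
    rw [fderiv_comp_smul, norm_smul, Real.norm_of_nonneg (hp n).le, mul_comm]
    exact mul_le_mul_of_nonneg_right (hM _) (hp n).le

lemma gl_A {ι : Type*} [Fintype ι] (v : ι → E) {g G : ℝ × E → ℝ} {Y : ι → ℝ × E → ℝ} {a b : ℝ}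
    (hg : ContDiffOn ℝ 1 g (Ioo a b ×ˢ (univ : Set E)))
    (hG : ContinuousOn G (Ioo a b ×ˢ (univ : Set E)))
    (hY : ∀ i, ContDiffOn ℝ 1 (Y i) (Ioo a b ×ˢ (univ : Set E)))
    {H : E → ℝ} (hH : Integrable H μ)
    (bg : ∀ t ∈ Ioo a b, ∀ x, |g (t, x)| ≤ H x)
    (bG : ∀ t ∈ Ioo a b, ∀ x, |G (t, x)| ≤ H x)
    (bY : ∀ i, ∀ t ∈ Ioo a b, ∀ x, |Y i (t, x)| ≤ H x)
    (hid : ∀ t ∈ Ioo a b, ∀ x, fderiv ℝ g (t, x) (1, 0)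
      = G (t, x) + ∑ i, fderiv ℝ (Y i) (t, x) (0, v i)) {t : ℝ} (ht : t ∈ Ioo a b) :
    HasDerivAt (fun t => ∫ x, g (t, x) ∂μ) (∫ x, G (t, x) ∂μ) t := by
  have hO : IsOpen (Ioo a b ×ˢ (univ : Set E)) := isOpen_Ioo.prod isOpen_univ
  obtain ⟨χ, M, hM0, hχ, hcs, h01, hlim, hder⟩ := gl_cutoff (E := E)
  have hdY : ∀ i, ContinuousOn (fun p => fderiv ℝ (Y i) p (0, v i)) (Ioo a b ×ˢ (univ : Set E)) :=
    fun i => ((hY i).continuousOn_fderiv_of_isOpen hO le_rfl).clm_apply continuousOn_const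
  have hcpt : ∀ n {f : E → ℝ}, Continuous f → Integrable (fun x => χ n x * f x) μ := fun n f hf =>
    ((hχ n).continuous.mul hf).integrable_of_hasCompactSupport (hcs n).mul_right
  have hdom : ∀ {f : E → ℝ}, Continuous f → (∀ x, |f x| ≤ H x) → Integrable f μ :=
    fun hf h => hH.mono' hf.aestronglyMeasurable (.of_forall h)
  -- derivative of the truncated integrals after integration by parts
  have key : ∀ n, ∀ s ∈ Ioo a b, ∫ x, χ n x * fderiv ℝ g (s, x) (1, 0) ∂μ
      = ∫ x, χ n x * G (s, x) ∂μ - ∑ i, ∫ x, fderiv ℝ (χ n) x (v i) * Y i (s, x) ∂μ := by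
    intro n s hs
    have e1 : ∀ x, χ n x * fderiv ℝ g (s, x) (1, 0)
        = χ n x * G (s, x) + ∑ i, χ n x * fderiv ℝ (Y i) (s, x) (0, v i) := by
      intro x
      rw [hid s hs x, mul_add, Finset.mul_sum]
    simp_rw [e1]
    rw [integral_add (hcpt n (gl_slice_cont hs hG))
      (integrable_finsetSum _ fun i _ => hcpt n (gl_slice_cont hs (hdY i))),
      integral_finsetSum _ fun i _ => hcpt n (gl_slice_cont hs (hdY i)), sub_eq_add_neg,
      ← Finset.sum_neg_distrib]
    congr 1
    refine Finset.sum_congr rfl fun i _ => ?_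
    have hdiff : ∀ x, HasFDerivAt (fun z => Y i (s, z))
        ((fderiv ℝ (Y i) (s, x)).comp (ContinuousLinearMap.inr ℝ ℝ E)) x := fun x =>
      gl_slice_x (((hY i).contDiffAt (hO.mem_nhds ⟨hs, mem_univ _⟩)).differentiableAt one_ne_zero)
    have e2 : ∀ x, fderiv ℝ (Y i) (s, x) (0, v i) = fderiv ℝ (fun z => Y i (s, z)) x (v i) := by
      intro x
      rw [(hdiff x).fderiv]
      simp
    have hi := hcpt n (gl_slice_cont hs (hdY i))
    simp_rw [e2] at hi ⊢
    refine integral_mul_fderiv_eq_neg_fderiv_mul_of_integrable ?_ hi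
      (hcpt n (gl_slice_cont hs (hY i).continuousOn))
      (fun x _ => ((hχ n).differentiable one_ne_zero) x) (fun x _ => (hdiff x).differentiableAt)
    refine Continuous.integrable_of_hasCompactSupport ?_ ?_
    · exact (((hχ n).continuous_fderiv one_ne_zero).clm_apply continuous_const).mul
        (gl_slice_cont hs (hY i).continuousOn)
    · exact HasCompactSupport.mul_right ((hcs n).fderiv_apply ℝ (v i))
  -- error terms
  have herr0 : Tendsto (fun n => ∫ x, (1 - χ n x) * H x ∂μ) atTop (𝓝 0) := by
    have := tendsto_integral_of_dominated_convergence (μ := μ)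
      (F := fun n x => (1 - χ n x) * H x) (f := fun x => 0) (fun x => |H x|)
      (fun n => ((continuous_const.sub (hχ n).continuous).aestronglyMeasurable).mul
        hH.aestronglyMeasurable) hH.abs
      (fun n => .of_forall fun x => by
        rw [Real.norm_eq_abs, abs_mul]
        refine mul_le_of_le_one_left (abs_nonneg _) ?_
        rw [abs_le]; constructor <;> linarith [(h01 n x).1, (h01 n x).2])
      (.of_forall fun x => by
        have := ((tendsto_const_nhds (x := (1 : ℝ))).sub (hlim x)).mul_const (H x)
        simpa using this)
    simpa using this
  have hiH : ∀ n, Integrable (fun x => (1 - χ n x) * H x) μ := fun n =>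
    hH.bdd_mul (c := 1) (continuous_const.sub (hχ n).continuous).aestronglyMeasurable
      (.of_forall fun x => by
        rw [Real.norm_eq_abs, abs_le]; constructor <;> linarith [(h01 n x).1, (h01 n x).2])
  have hcut : ∀ n {f : E → ℝ}, Continuous f → (∀ x, |f x| ≤ H x) →
      |∫ x, f x ∂μ - ∫ x, χ n x * f x ∂μ| ≤ ∫ x, (1 - χ n x) * H x ∂μ := by
    intro n f hf hb
    rw [← integral_sub (hdom hf hb) (hcpt n hf)]
    rw [← Real.norm_eq_abs]
    refine norm_integral_le_of_norm_le (hiH n) (.of_forall fun x => ?_)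
    have : f x - χ n x * f x = (1 - χ n x) * f x := by ring
    rw [this, norm_mul, Real.norm_of_nonneg (by linarith [(h01 n x).2])]
    exact mul_le_mul_of_nonneg_left (hb x) (by linarith [(h01 n x).2])
  have hbdry : ∀ n i, ∀ s ∈ Ioo a b, |∫ x, fderiv ℝ (χ n) x (v i) * Y i (s, x) ∂μ|
      ≤ ((n : ℝ) + 1)⁻¹ * (M * ‖v i‖ * ∫ x, H x ∂μ) := by
    intro n i s hs
    have : ((n : ℝ) + 1)⁻¹ * (M * ‖v i‖ * ∫ x, H x ∂μ)
        = ∫ x, (((n : ℝ) + 1)⁻¹ * (M * ‖v i‖)) * H x ∂μ := by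
      rw [integral_const_mul]; ring
    rw [this, ← Real.norm_eq_abs]
    refine norm_integral_le_of_norm_le (hH.const_mul _) (.of_forall fun x => ?_)
    rw [norm_mul]
    refine mul_le_mul ?_ (bY i s hs x) (norm_nonneg _) (by positivity)
    refine (ContinuousLinearMap.le_opNorm _ _).trans ?_
    refine (mul_le_mul_of_nonneg_right (hder n x) (norm_nonneg _)).trans_eq (by ring)
  have herr1 : Tendsto (fun n : ℕ => ∫ x, (1 - χ n x) * H x ∂μ +
      ((n : ℝ) + 1)⁻¹ * ∑ i, (M * ‖v i‖ * ∫ x, H x ∂μ)) atTop (𝓝 0) := by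
    have h0 : Tendsto (fun n : ℕ => ((n : ℝ) + 1)⁻¹) atTop (𝓝 0) := by
      simpa using tendsto_one_div_add_atTop_nhds_zero_nat (𝕜 := ℝ)
    simpa using herr0.add (h0.mul_const (∑ i, (M * ‖v i‖ * ∫ x, H x ∂μ)))
  refine hasDerivAt_of_tendstoUniformlyOn (l := atTop) isOpen_Ioo
    (f := fun n t => ∫ x, χ n x * g (t, x) ∂μ)
    (f' := fun n t => ∫ x, χ n x * fderiv ℝ g (t, x) (1, 0) ∂μ)
    (g' := fun t => ∫ x, G (t, x) ∂μ) ?_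
    (.of_forall fun n s hs => gl_param μ hg (hχ n).continuous (hcs n) hs) ?_ ht
  · rw [Metric.tendstoUniformlyOn_iff]
    intro ε hε
    filter_upwards [herr1.eventually (gt_mem_nhds hε)] with n hn s hs
    refine lt_of_le_of_lt ?_ hn
    rw [key n s hs, Real.dist_eq, ← sub_add]
    refine (abs_add_le _ _).trans (add_le_add (hcut n (gl_slice_cont hs hG) (bG s hs)) ?_)
    rw [Finset.mul_sum]
    exact (Finset.abs_sum_le_sum_abs _ _).trans (Finset.sum_le_sum fun i _ => hbdry n i s hs)
  · intro s hs
    rw [tendsto_iff_dist_tendsto_zero]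
    refine squeeze_zero (fun _ => dist_nonneg) (fun n => ?_) herr0
    rw [dist_comm, Real.dist_eq]
    exact hcut n (gl_slice_cont hs hg.continuousOn) (bg s hs)

end GLaux

section GLalg
open Filter Topology Set

lemma gl_alg {N : ℕ} (ξ : Fin N → ℝ) (u ut w : ℂ) (D Dt : Fin N → ℂ) (D2 : Fin N → Fin N → ℂ)
    (hsymm : ∀ i j, D2 i j = D2 j i) (f s k e : ℝ) (hs : s ≠ 0)
    (hpde : ut = ∑ i, D2 i i + f • u)
    (hw : w = ut - (2 * s)⁻¹ • ∑ i, ξ i • D i) :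
    (∑ j, inner ℝ (D j) (Dt j) - f * inner ℝ u ut) * k
        + e * (k * (N / (2 * s) - (∑ j, ξ j ^ 2) / (4 * s ^ 2)))
      = k * ((∑ j, ‖D j‖ ^ 2) / (2 * s) - ‖w‖ ^ 2) +
        ∑ i, (((inner ℝ w (D2 i i)
            + inner ℝ (Dt i - (2 * s)⁻¹ • (D i + ∑ j, ξ j • D2 j i)) (D i)) * k
          + inner ℝ w (D i) * (k * (-(ξ i / (2 * s)))))
          + ((((∑ j, inner ℝ (D j) (D2 j i) - f * inner ℝ u (D i)) * ξ i + e) / (2 * s)) * k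
            + (e * ξ i / (2 * s)) * (k * (-(ξ i / (2 * s)))))) := by
  have h1 : ∀ i, (((inner ℝ w (D2 i i)
            + inner ℝ (Dt i - (2 * s)⁻¹ • (D i + ∑ j, ξ j • D2 j i)) (D i)) * k
          + inner ℝ w (D i) * (k * (-(ξ i / (2 * s)))))
          + ((((∑ j, inner ℝ (D j) (D2 j i) - f * inner ℝ u (D i)) * ξ i + e) / (2 * s)) * k
            + (e * ξ i / (2 * s)) * (k * (-(ξ i / (2 * s))))))
      = inner ℝ w (D2 i i) * k + inner ℝ (D i) (Dt i) * k - ‖D i‖ ^ 2 * (k / (2 * s))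
        - (∑ j, ξ j * inner ℝ (D i) (D2 i j)) * (k / (2 * s))
        - (ξ i * inner ℝ w (D i)) * (k / (2 * s))
        + (∑ j, ξ i * inner ℝ (D j) (D2 j i)) * (k / (2 * s))
        - (ξ i * inner ℝ u (D i)) * (f * k / (2 * s))
        + e * k / (2 * s) - ξ i ^ 2 * (e * k / (4 * s ^ 2)) := by
    intro i
    have e1 : inner ℝ (∑ j, ξ j • D2 j i) (D i) = ∑ j, ξ j * inner ℝ (D i) (D2 i j) := by
      rw [sum_inner]
      refine Finset.sum_congr rfl fun j _ => ?_
      rw [real_inner_smul_left, real_inner_comm, hsymm]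
    rw [inner_sub_left, real_inner_smul_left, inner_add_left, e1, real_inner_self_eq_norm_sq,
      real_inner_comm (D i) (Dt i), ← Finset.mul_sum]
    field_simp
    ring
  have e2 : inner ℝ w (∑ i, D2 i i) = ‖w‖ ^ 2 + (∑ i, ξ i * inner ℝ w (D i)) / (2 * s)
      - f * inner ℝ u w := by
    have : ∑ i, D2 i i = w + (2 * s)⁻¹ • ∑ i, ξ i • D i - f • u := by
      rw [hw, hpde]; abel
    rw [this, inner_sub_right, inner_add_right, real_inner_smul_right, real_inner_smul_right,
      inner_sum, real_inner_self_eq_norm_sq, real_inner_comm w u]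
    simp_rw [real_inner_smul_right]
    ring
  have e3 : inner ℝ u w = inner ℝ u ut - (∑ i, ξ i * inner ℝ u (D i)) / (2 * s) := by
    rw [hw, inner_sub_right, real_inner_smul_right, inner_sum]
    simp_rw [real_inner_smul_right]
    ring
  have e4 : ∑ i, ∑ j, ξ j * inner ℝ (D i) (D2 i j) = ∑ i, ∑ j, ξ i * inner ℝ (D j) (D2 j i) :=
    Finset.sum_comm
  simp_rw [h1]
  simp only [Finset.sum_add_distrib, Finset.sum_sub_distrib, ← Finset.sum_mul]
  rw [← inner_sum, e2, e3, e4]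
  simp only [Finset.sum_const, Finset.card_univ, Fintype.card_fin, nsmul_eq_mul]
  field_simp
  ring

lemma gl_gauss {N : ℕ} (y : EuclideanSpace ℝ (Fin N)) {c : ℝ} (hc : 0 < c) :
    Integrable (fun x : EuclideanSpace ℝ (Fin N) =>
      (1 + ‖x - y‖ ^ 2) * Real.exp (-‖x - y‖ ^ 2 / c)) := by
  have h0 : Integrable (fun v : EuclideanSpace ℝ (Fin N) => Real.exp (-‖v‖ ^ 2 / (2 * c))) := by
    have := (GaussianFourier.integrable_cexp_neg_mul_sq_norm_add
      (b := (((2 * c)⁻¹ : ℝ) : ℂ)) (by rw [Complex.ofReal_re]; positivity) 0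
      (0 : EuclideanSpace ℝ (Fin N))).norm
    refine this.congr (.of_forall fun v => ?_)
    simp only [Complex.norm_exp]
    congr 1
    rw [zero_mul, add_zero, ← Complex.ofReal_neg, ← Complex.ofReal_pow, ← Complex.ofReal_mul,
      Complex.ofReal_re]
    ring
  have h1 := (h0.comp_sub_right y).const_mul (1 + 2 * c)
  refine h1.mono' (by fun_prop) (.of_forall fun x => ?_)
  rw [Real.norm_of_nonneg (by positivity)]
  set q := ‖x - y‖ ^ 2
  have hq : 0 ≤ q := by positivity
  have e1 : Real.exp (-q / c) = Real.exp (-(q / (2 * c))) * Real.exp (-q / (2 * c)) := by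
    rw [← Real.exp_add]; congr 1; field_simp; ring
  rw [e1, ← mul_assoc]
  refine mul_le_mul_of_nonneg_right ?_ (Real.exp_pos _).le
  have h2 : q / (2 * c) * Real.exp (-(q / (2 * c))) ≤ 1 := by
    rw [Real.exp_neg, ← div_eq_mul_inv, div_le_one (Real.exp_pos _)]
    linarith [Real.add_one_le_exp (q / (2 * c))]
  have h3 : Real.exp (-(q / (2 * c))) ≤ 1 := Real.exp_le_one_iff.2 (by
    have : 0 ≤ q / (2 * c) := by positivity
    linarith)
  have h4 : q * Real.exp (-(q / (2 * c))) ≤ 2 * c := by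
    have : q * Real.exp (-(q / (2 * c))) = 2 * c * (q / (2 * c) * Real.exp (-(q / (2 * c)))) := by
      field_simp
    rw [this]
    nlinarith
  linarith
end GLalg


section GLmain
open Filter Topology Set

variable {N : ℕ}

/-- time derivative -/
noncomputable def gl_ut (u : ℝ × EuclideanSpace ℝ (Fin N) → ℂ)
    (p : ℝ × EuclideanSpace ℝ (Fin N)) : ℂ := fderiv ℝ u p (1, 0)

/-- space derivative -/
noncomputable def gl_D (u : ℝ × EuclideanSpace ℝ (Fin N) → ℂ) (i : Fin N)
    (p : ℝ × EuclideanSpace ℝ (Fin N)) : ℂ := fderiv ℝ u p (0, EuclideanSpace.single i 1)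

/-- heat kernel -/
noncomputable def gl_k (T : ℝ) (y : EuclideanSpace ℝ (Fin N))
    (p : ℝ × EuclideanSpace ℝ (Fin N)) : ℝ :=
  (4 * Real.pi * (T - p.1)) ^ (-(N : ℝ) / 2) * Real.exp (-‖p.2 - y‖ ^ 2 / (4 * (T - p.1)))

/-- energy -/
noncomputable def gl_e (ε : ℝ) (u : ℝ × EuclideanSpace ℝ (Fin N) → ℂ)
    (p : ℝ × EuclideanSpace ℝ (Fin N)) : ℝ :=
  (1 / 2) * (∑ i, ‖gl_D u i p‖ ^ 2) + (1 - ‖u p‖ ^ 2) ^ 2 / (4 * ε ^ 2)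

/-- similarity vector -/
noncomputable def gl_w (T : ℝ) (y : EuclideanSpace ℝ (Fin N))
    (u : ℝ × EuclideanSpace ℝ (Fin N) → ℂ) (p : ℝ × EuclideanSpace ℝ (Fin N)) : ℂ :=
  gl_ut u p - (2 * (T - p.1))⁻¹ • ∑ i, (p.2 i - y i) • gl_D u i p

/-- flux -/
noncomputable def gl_Y (ε T : ℝ) (y : EuclideanSpace ℝ (Fin N))
    (u : ℝ × EuclideanSpace ℝ (Fin N) → ℂ) (i : Fin N) (p : ℝ × EuclideanSpace ℝ (Fin N)) : ℝ :=
  inner ℝ (gl_w T y u p) (gl_D u i p) * gl_k T y p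
    + gl_e ε u p * (p.2 i - y i) / (2 * (T - p.1)) * gl_k T y p

/-- bulk term -/
noncomputable def gl_G (T : ℝ) (y : EuclideanSpace ℝ (Fin N))
    (u : ℝ × EuclideanSpace ℝ (Fin N) → ℂ) (p : ℝ × EuclideanSpace ℝ (Fin N)) : ℝ :=
  gl_k T y p * ((∑ j, ‖gl_D u j p‖ ^ 2) / (2 * (T - p.1)) - ‖gl_w T y u p‖ ^ 2)

lemma gl_line_coord (y : EuclideanSpace ℝ (Fin N)) (p v : ℝ × EuclideanSpace ℝ (Fin N))
    (i : Fin N) : HasLineDerivAt ℝ (fun p : ℝ × EuclideanSpace ℝ (Fin N) => p.2 i - y i)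
      (v.2 i) p v := by
  unfold HasLineDerivAt
  simp only [Prod.snd_add, Prod.smul_snd, PiLp.add_apply, PiLp.smul_apply, smul_eq_mul]
  simpa using (((hasDerivAt_id (0 : ℝ)).mul_const (v.2 i)).const_add (p.2 i)).sub_const (y i)

lemma gl_line_time (T : ℝ) (p v : ℝ × EuclideanSpace ℝ (Fin N)) :
    HasLineDerivAt ℝ (fun p : ℝ × EuclideanSpace ℝ (Fin N) => T - p.1) (-v.1) p v := by
  unfold HasLineDerivAt
  simp only [Prod.fst_add, Prod.smul_fst, smul_eq_mul]
  simpa using (((hasDerivAt_id (0 : ℝ)).mul_const (v.1)).const_add (p.1)).const_sub T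

lemma gl_normsq (x y : EuclideanSpace ℝ (Fin N)) : ‖x - y‖ ^ 2 = ∑ j, (x j - y j) ^ 2 := by
  rw [EuclideanSpace.norm_sq_eq]
  simp

lemma gl_line_k (T : ℝ) (y : EuclideanSpace ℝ (Fin N)) (p v : ℝ × EuclideanSpace ℝ (Fin N))
    (hp : p.1 < T) : HasLineDerivAt ℝ (gl_k T y) (gl_k T y p * (N * v.1 / (2 * (T - p.1))
      - (∑ j, (p.2 j - y j) * v.2 j) / (2 * (T - p.1))
      - v.1 * (∑ j, (p.2 j - y j) ^ 2) / (4 * (T - p.1) ^ 2))) p v := by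
  have hs : 0 < T - p.1 := by linarith
  have hk : gl_k T y = fun p => (4 * Real.pi * (T - p.1)) ^ (-(N : ℝ) / 2)
      * Real.exp (-(∑ j, (p.2 j - y j) ^ 2) / (4 * (T - p.1))) := by
    funext p
    rw [gl_k, gl_normsq]
  rw [hk]
  have h1 : HasDerivAt (fun h : ℝ => T - (p + h • v).1) (-v.1) 0 := gl_line_time T p v
  have h2 : ∀ j, HasDerivAt (fun h : ℝ => (p + h • v).2 j - y j) (v.2 j) 0 :=
    fun j => gl_line_coord y p v j
  have h3 := HasDerivAt.fun_sum (u := Finset.univ) (fun j _ => (h2 j).fun_pow 2)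
  have h4 := (h1.const_mul (4 * Real.pi)).rpow_const (p := -(N : ℝ) / 2)
    (by left; simp only [zero_smul, add_zero]; positivity)
  have h5 := (h3.fun_neg.fun_div (h1.const_mul 4) (by simp only [zero_smul, add_zero]; positivity)).exp
  have h6 := h4.fun_mul h5
  refine HasDerivAt.congr_deriv h6 ?_
  simp only [zero_smul, add_zero]
  have e1 : (4 * Real.pi * (T - p.1)) ^ (-(N : ℝ) / 2 - 1)
      = (4 * Real.pi * (T - p.1)) ^ (-(N : ℝ) / 2) / (4 * Real.pi * (T - p.1)) :=
    Real.rpow_sub_one (by positivity) _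
  rw [e1]
  have e2 : ∑ j, ((2 : ℕ) : ℝ) * (p.2 j - y j) ^ (2 - 1) * v.2 j
      = 2 * ∑ j, (p.2 j - y j) * v.2 j := by
    rw [Finset.mul_sum]
    refine Finset.sum_congr rfl fun j _ => ?_
    norm_num
    ring
  rw [e2]
  field_simp
  ring

lemma gl_line_e {ε : ℝ} (hε : 0 < ε) (u : ℝ × EuclideanSpace ℝ (Fin N) → ℂ)
    (p v : ℝ × EuclideanSpace ℝ (Fin N)) {du : ℂ} {dD : Fin N → ℂ}
    (hu : HasLineDerivAt ℝ u du p v) (hD : ∀ j, HasLineDerivAt ℝ (gl_D u j) (dD j) p v) :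
    HasLineDerivAt ℝ (gl_e ε u) (∑ j, inner ℝ (gl_D u j p) (dD j)
      - ((ε ^ 2)⁻¹ * (1 - ‖u p‖ ^ 2)) * inner ℝ (u p) du) p v := by
  have h1 : HasDerivAt (fun h : ℝ => ‖u (p + h • v)‖ ^ 2)
      (2 * inner ℝ (u (p + (0 : ℝ) • v)) du) 0 := HasDerivAt.norm_sq hu
  have h2 : ∀ j, HasDerivAt (fun h : ℝ => ‖gl_D u j (p + h • v)‖ ^ 2)
      (2 * inner ℝ (gl_D u j (p + (0 : ℝ) • v)) (dD j)) 0 := fun j => HasDerivAt.norm_sq (hD j)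
  have h3 := ((HasDerivAt.fun_sum (u := Finset.univ) (fun j _ => h2 j)).const_mul (1 / 2)).fun_add
    (((h1.const_sub 1).fun_pow 2).div_const (4 * ε ^ 2))
  refine HasDerivAt.congr_deriv h3 ?_
  simp only [zero_smul, add_zero, ← Finset.mul_sum]
  norm_num
  field_simp
  ring

lemma gl_line_w {T : ℝ} (y : EuclideanSpace ℝ (Fin N)) (u : ℝ × EuclideanSpace ℝ (Fin N) → ℂ)
    (p : ℝ × EuclideanSpace ℝ (Fin N)) (i : Fin N) {dt : ℂ} {dD : Fin N → ℂ}
    (hu : HasLineDerivAt ℝ (gl_ut u) dt p (0, EuclideanSpace.single i 1))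
    (hD : ∀ j, HasLineDerivAt ℝ (gl_D u j) (dD j) p (0, EuclideanSpace.single i 1)) :
    HasLineDerivAt ℝ (gl_w T y u) (dt - (2 * (T - p.1))⁻¹ •
      (gl_D u i p + ∑ j, (p.2 j - y j) • dD j)) p (0, EuclideanSpace.single i 1) := by
  have h2 : ∀ j, HasDerivAt
      (fun h : ℝ => (p + h • ((0 : ℝ), EuclideanSpace.single i (1 : ℝ))).2 j - y j)
      ((EuclideanSpace.single i (1 : ℝ)) j) 0 :=
    fun j => gl_line_coord y p (0, EuclideanSpace.single i 1) j
  have h3 := HasDerivAt.fun_sub hu ((HasDerivAt.fun_sum (u := Finset.univ)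
    (fun j _ => (h2 j).fun_smul (hD j))).fun_const_smul ((2 * (T - p.1))⁻¹))
  refine HasDerivAt.congr_deriv (h3.congr_of_eventuallyEq (.of_forall fun h => ?_)) ?_
  · have hh : (p + h • ((0 : ℝ), EuclideanSpace.single i (1 : ℝ))).1 = p.1 := by simp
    simp only [gl_w, hh]
  congr 2
  simp only [zero_smul, add_zero, Finset.sum_add_distrib]
  rw [add_comm]
  congr 1
  rw [Finset.sum_eq_single i]
  · simp
  · intro j _ hj
    simp [hj]
  · simp

lemma gl_line_Y {ε T : ℝ} (hε : 0 < ε) (y : EuclideanSpace ℝ (Fin N))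
    (u : ℝ × EuclideanSpace ℝ (Fin N) → ℂ)
    (p : ℝ × EuclideanSpace ℝ (Fin N)) (hp : p.1 < T) (i : Fin N) {dt : ℂ} {dD : Fin N → ℂ}
    (hu : HasLineDerivAt ℝ u (gl_D u i p) p (0, EuclideanSpace.single i 1))
    (hut : HasLineDerivAt ℝ (gl_ut u) dt p (0, EuclideanSpace.single i 1))
    (hD : ∀ j, HasLineDerivAt ℝ (gl_D u j) (dD j) p (0, EuclideanSpace.single i 1)) :
    HasLineDerivAt ℝ (gl_Y ε T y u i)
      (((inner ℝ (gl_w T y u p) (dD i)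
            + inner ℝ (dt - (2 * (T - p.1))⁻¹ •
                (gl_D u i p + ∑ j, (p.2 j - y j) • dD j)) (gl_D u i p)) * gl_k T y p
          + inner ℝ (gl_w T y u p) (gl_D u i p) *
            (gl_k T y p * (-((p.2 i - y i) / (2 * (T - p.1))))))
        + ((((∑ j, inner ℝ (gl_D u j p) (dD j) - ((ε ^ 2)⁻¹ * (1 - ‖u p‖ ^ 2))
              * inner ℝ (u p) (gl_D u i p)) * (p.2 i - y i) + gl_e ε u p) / (2 * (T - p.1)))
              * gl_k T y p
            + (gl_e ε u p * (p.2 i - y i) / (2 * (T - p.1)))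
              * (gl_k T y p * (-((p.2 i - y i) / (2 * (T - p.1)))))))
      p (0, EuclideanSpace.single i 1) := by
  have hw := gl_line_w (T := T) y u p i hut hD
  have he := gl_line_e hε u p _ hu hD
  have hk := gl_line_k T y p (0, EuclideanSpace.single i 1) hp
  have hx := gl_line_coord y p (0, EuclideanSpace.single i 1) i
  have hin := HasDerivAt.inner ℝ hw (hD i)
  have h1 := (HasDerivAt.fun_mul hin hk).fun_add
    (((HasDerivAt.fun_mul he hx).div_const (2 * (T - p.1))).fun_mul hk)
  refine HasDerivAt.congr_deriv (h1.congr_of_eventuallyEq (.of_forall fun h => ?_)) ?_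
  · have hh : (p + h • ((0 : ℝ), EuclideanSpace.single i (1 : ℝ))).1 = p.1 := by simp
    simp only [gl_Y, hh]
  have e1 : ∑ j, (p.2 j - y j) * (EuclideanSpace.single i (1 : ℝ)) j = p.2 i - y i := by
    rw [Finset.sum_eq_single i]
    · simp
    · intro j _ hj
      simp [hj]
    · simp
  simp only [zero_smul, add_zero, e1]
  simp


lemma gl_symm {u : ℝ × EuclideanSpace ℝ (Fin N) → ℂ} {p : ℝ × EuclideanSpace ℝ (Fin N)}
    (hu : ContDiffAt ℝ 2 u p) (a b : ℝ × EuclideanSpace ℝ (Fin N)) :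
    fderiv ℝ (fun q => fderiv ℝ u q a) p b = fderiv ℝ (fun q => fderiv ℝ u q b) p a := by
  have hs := hu.isSymmSndFDerivAt (by simp)
  have hd : DifferentiableAt ℝ (fderiv ℝ u) p :=
    (hu.fderiv_right (m := 1) (by norm_num)).differentiableAt one_ne_zero
  have h : ∀ a b, fderiv ℝ (fun q => fderiv ℝ u q a) p b = fderiv ℝ (fderiv ℝ u) p b a := by
    intro a b
    rw [fderiv_clm_apply hd (differentiableAt_const a)]
    simp
  rw [h, h]
  exact hs.eq b a

section smooth
variable {ε T : ℝ} {y : EuclideanSpace ℝ (Fin N)} {u : ℝ × EuclideanSpace ℝ (Fin N) → ℂ}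

lemma gl_open : IsOpen (Ioo 0 T ×ˢ (univ : Set (EuclideanSpace ℝ (Fin N)))) :=
  isOpen_Ioo.prod isOpen_univ

lemma gl_cd_d (hu : ContDiffOn ℝ 2 u (Ioo 0 T ×ˢ (univ : Set (EuclideanSpace ℝ (Fin N)))))
    (v : ℝ × EuclideanSpace ℝ (Fin N)) :
    ContDiffOn ℝ 1 (fun p => fderiv ℝ u p v)
      (Ioo 0 T ×ˢ (univ : Set (EuclideanSpace ℝ (Fin N)))) :=
  (hu.fderiv_of_isOpen gl_open (by norm_num)).clm_apply contDiffOn_const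

lemma gl_cd_k : ContDiffOn ℝ 1 (gl_k T y)
      (Ioo 0 T ×ˢ (univ : Set (EuclideanSpace ℝ (Fin N)))) := by
  have h1 : ∀ p ∈ Ioo 0 T ×ˢ (univ : Set (EuclideanSpace ℝ (Fin N))), 0 < T - p.1 :=
    fun p hp => sub_pos.2 hp.1.2
  have hS : ContDiffOn ℝ 1 (fun p : ℝ × EuclideanSpace ℝ (Fin N) => T - p.1)
      (Ioo 0 T ×ˢ (univ : Set (EuclideanSpace ℝ (Fin N)))) := by fun_prop
  unfold gl_k
  refine ContDiffOn.mul (ContDiffOn.rpow_const_of_ne (contDiffOn_const.mul hS) ?_)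
    (ContDiffOn.exp (ContDiffOn.div ?_ (contDiffOn_const.mul hS) ?_))
  · intro p hp
    have := h1 p hp
    positivity
  · exact (ContDiffOn.norm_sq ℝ (by fun_prop)).neg
  · intro p hp
    have := h1 p hp
    positivity

lemma gl_cd_e (hu : ContDiffOn ℝ 2 u (Ioo 0 T ×ˢ (univ : Set (EuclideanSpace ℝ (Fin N))))) :
    ContDiffOn ℝ 1 (gl_e ε u) (Ioo 0 T ×ˢ (univ : Set (EuclideanSpace ℝ (Fin N)))) := by
  unfold gl_e
  refine (contDiffOn_const.mul (ContDiffOn.sum fun i _ => ContDiffOn.norm_sq ℝ ?_)).add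
    (ContDiffOn.div_const ((contDiffOn_const.sub (ContDiffOn.norm_sq ℝ ?_)).pow 2) _)
  · exact gl_cd_d hu _
  · exact hu.of_le (by norm_num)

lemma gl_cd_coord (i : Fin N) (s : Set (ℝ × EuclideanSpace ℝ (Fin N))) :
    ContDiffOn ℝ 1 (fun p : ℝ × EuclideanSpace ℝ (Fin N) => p.2 i - y i) s := by
  fun_prop

lemma gl_cd_s : ContDiffOn ℝ 1 (fun p : ℝ × EuclideanSpace ℝ (Fin N) => (2 * (T - p.1))⁻¹)
      (Ioo 0 T ×ˢ (univ : Set (EuclideanSpace ℝ (Fin N)))) := by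
  refine ContDiffOn.inv (by fun_prop) ?_
  intro p hp
  have : 0 < T - p.1 := sub_pos.2 hp.1.2
  positivity

lemma gl_cd_w (hu : ContDiffOn ℝ 2 u (Ioo 0 T ×ˢ (univ : Set (EuclideanSpace ℝ (Fin N))))) :
    ContDiffOn ℝ 1 (gl_w T y u) (Ioo 0 T ×ˢ (univ : Set (EuclideanSpace ℝ (Fin N)))) := by
  unfold gl_w
  exact (gl_cd_d hu _).sub (gl_cd_s.smul
    (ContDiffOn.sum fun i _ => (gl_cd_coord i _).smul (gl_cd_d hu _)))

lemma gl_cd_Y (hu : ContDiffOn ℝ 2 u (Ioo 0 T ×ˢ (univ : Set (EuclideanSpace ℝ (Fin N)))))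
    (i : Fin N) :
    ContDiffOn ℝ 1 (gl_Y ε T y u i) (Ioo 0 T ×ˢ (univ : Set (EuclideanSpace ℝ (Fin N)))) := by
  unfold gl_Y
  simp only [div_eq_mul_inv]
  exact ((ContDiffOn.inner ℝ (gl_cd_w hu) (gl_cd_d hu _)).mul gl_cd_k).add
    ((((gl_cd_e hu).mul (gl_cd_coord i _)).mul gl_cd_s).mul gl_cd_k)

lemma gl_cd_G (hu : ContDiffOn ℝ 2 u (Ioo 0 T ×ˢ (univ : Set (EuclideanSpace ℝ (Fin N))))) :
    ContDiffOn ℝ 1 (gl_G T y u) (Ioo 0 T ×ˢ (univ : Set (EuclideanSpace ℝ (Fin N)))) := by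
  unfold gl_G
  simp only [div_eq_mul_inv]
  exact gl_cd_k.mul (((ContDiffOn.sum fun i _ => ContDiffOn.norm_sq ℝ (gl_cd_d hu _)).mul
    gl_cd_s).sub (ContDiffOn.norm_sq ℝ (gl_cd_w hu)))

lemma gl_identity (hε : 0 < ε)
    (hu : ContDiffOn ℝ 2 u (Ioo 0 T ×ˢ (univ : Set (EuclideanSpace ℝ (Fin N)))))
    (p : ℝ × EuclideanSpace ℝ (Fin N)) (hp : p ∈ Ioo 0 T ×ˢ (univ : Set (EuclideanSpace ℝ (Fin N))))
    (hpde : gl_ut u p = ∑ i, fderiv ℝ (gl_D u i) p (0, EuclideanSpace.single i 1)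
      + ((ε ^ 2)⁻¹ * (1 - ‖u p‖ ^ 2)) • u p) :
    fderiv ℝ (fun p => gl_e ε u p * gl_k T y p) p (1, 0)
      = gl_G T y u p + ∑ i, fderiv ℝ (gl_Y ε T y u i) p (0, EuclideanSpace.single i 1) := by
  have hn := gl_open.mem_nhds hp
  have hu2 : ContDiffAt ℝ 2 u p := hu.contDiffAt hn
  have hline : ∀ {F : Type} [NormedAddCommGroup F] [NormedSpace ℝ F]
      {f : ℝ × EuclideanSpace ℝ (Fin N) → F},
      ContDiffOn ℝ 1 f (Ioo 0 T ×ˢ (univ : Set (EuclideanSpace ℝ (Fin N)))) → ∀ v,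
      HasLineDerivAt ℝ f (fderiv ℝ f p v) p v := fun h v =>
    (((h.contDiffAt hn).differentiableAt one_ne_zero).hasFDerivAt).hasLineDerivAt v
  have hu1 : ContDiffOn ℝ 1 u (Ioo 0 T ×ˢ (univ : Set (EuclideanSpace ℝ (Fin N)))) :=
    hu.of_le (by norm_num)
  have hD : ∀ j v, HasLineDerivAt ℝ (gl_D u j) (fderiv ℝ (gl_D u j) p v) p v :=
    fun j v => hline (gl_cd_d hu _) v
  have hY : ∀ i, fderiv ℝ (gl_Y ε T y u i) p (0, EuclideanSpace.single i 1) = _ := fun i =>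
    (hline (gl_cd_Y hu i) _).unique
    (gl_line_Y hε y u p hp.1.2 i (hline hu1 _) (hline (gl_cd_d hu _) _) (fun j => hD j _))
  have hk := gl_line_k T y p (1, 0) hp.1.2
  have he := gl_line_e hε u p (1, 0) (hline hu1 _) (fun j => hD j _)
  have hg : fderiv ℝ (fun p => gl_e ε u p * gl_k T y p) p (1, 0) = _ :=
    (hline ((gl_cd_e hu).mul gl_cd_k) _).unique (HasDerivAt.fun_mul he hk)
  rw [hg]
  simp_rw [hY]
  have hs : T - p.1 ≠ 0 := (sub_pos.2 hp.1.2).ne'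
  have ht : ∀ i, fderiv ℝ (fun q => fderiv ℝ u q (1, 0)) p (0, EuclideanSpace.single i 1)
      = fderiv ℝ (gl_D u i) p (1, 0) := fun i => gl_symm hu2 _ _
  have := gl_alg (fun i => p.2 i - y i) (u p) (gl_ut u p) (gl_w T y u p) (fun i => gl_D u i p)
    (fun i => fderiv ℝ (gl_D u i) p (1, 0))
    (fun i j => fderiv ℝ (gl_D u i) p (0, EuclideanSpace.single j 1))
    (fun i j => gl_symm hu2 _ _) ((ε ^ 2)⁻¹ * (1 - ‖u p‖ ^ 2)) (T - p.1) (gl_k T y p)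
    (gl_e ε u p) hs hpde rfl
  simp_rw [ht]
  rw [gl_G, ← this]
  simp only [zero_smul, add_zero, gl_ut]
  simp

end smooth


set_option maxHeartbeats 1000000 in
lemma gl_bounds (ε T : ℝ) (y : EuclideanSpace ℝ (Fin N))
    (u : ℝ × EuclideanSpace ℝ (Fin N) → ℂ) {C s0 s1 : ℝ} (hε : 0 < ε) (hs0 : 0 < s0) (hC : 0 ≤ C) :
    ∃ B : ℝ, ∀ p : ℝ × EuclideanSpace ℝ (Fin N), s0 ≤ T - p.1 → T - p.1 ≤ s1 →
      ‖u p‖ ≤ C → ‖gl_ut u p‖ ≤ C → (∀ i, ‖gl_D u i p‖ ≤ C) →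
      |gl_e ε u p * gl_k T y p| ≤ B * ((1 + ‖p.2 - y‖ ^ 2) * Real.exp (-‖p.2 - y‖ ^ 2 / (4 * s1))) ∧
      |gl_G T y u p| ≤ B * ((1 + ‖p.2 - y‖ ^ 2) * Real.exp (-‖p.2 - y‖ ^ 2 / (4 * s1))) ∧
      ∀ i, |gl_Y ε T y u i p|
        ≤ B * ((1 + ‖p.2 - y‖ ^ 2) * Real.exp (-‖p.2 - y‖ ^ 2 / (4 * s1))) := by
  obtain ⟨c0, hc0⟩ : ∃ c0, c0 = (4 * Real.pi * s0) ^ (-(N : ℝ) / 2) := ⟨_, rfl⟩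
  obtain ⟨Eb, hEb⟩ : ∃ Eb, Eb = 1 / 2 * (N * C ^ 2) + (1 + C ^ 2) ^ 2 / (4 * ε ^ 2) := ⟨_, rfl⟩
  obtain ⟨W, hW⟩ : ∃ W, W = C + (2 * s0)⁻¹ * (N * C) := ⟨_, rfl⟩
  obtain ⟨Q, hQ⟩ : ∃ Q, Q = N * C ^ 2 / (2 * s0) := ⟨_, rfl⟩
  obtain ⟨E2, hE2⟩ : ∃ E2, E2 = Eb * (2 * s0)⁻¹ := ⟨_, rfl⟩
  have hc0' : 0 ≤ c0 := by rw [hc0]; positivity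
  have hEb' : 0 ≤ Eb := by rw [hEb]; positivity
  have hW' : 0 ≤ W := by rw [hW]; positivity
  have hQ' : 0 ≤ Q := by rw [hQ]; positivity
  have hE2' : 0 ≤ E2 := by rw [hE2]; positivity
  have hWC : 0 ≤ W * C := by positivity
  refine ⟨(Eb + (Q + 2 * W ^ 2) + (2 * (W * C) + E2)) * c0, fun p h0 h1 hu hut hD => ?_⟩
  have hS : 0 < T - p.1 := hs0.trans_le h0
  set r := ‖p.2 - y‖ with hr
  have hr0 : 0 ≤ r := norm_nonneg _
  have hk0 : 0 ≤ gl_k T y p := by unfold gl_k; positivity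
  have hk : gl_k T y p ≤ c0 * Real.exp (-r ^ 2 / (4 * s1)) := by
    unfold gl_k
    rw [hc0]
    refine mul_le_mul ?_ ?_ (Real.exp_pos _).le (by positivity)
    · refine Real.rpow_le_rpow_of_nonpos (by positivity) (by gcongr) ?_
      have : (0 : ℝ) ≤ N := Nat.cast_nonneg N
      linarith
    · rw [Real.exp_le_exp, neg_div, neg_div, neg_le_neg_iff]
      gcongr
  have hinv : (2 * (T - p.1))⁻¹ ≤ (2 * s0)⁻¹ := by gcongr
  have hinv0 : 0 ≤ (2 * (T - p.1))⁻¹ := by positivity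
  have hsum : ∑ i, ‖gl_D u i p‖ ^ 2 ≤ N * C ^ 2 := by
    have : ∑ i, ‖gl_D u i p‖ ^ 2 ≤ ∑ _i : Fin N, C ^ 2 :=
      Finset.sum_le_sum fun i _ => pow_le_pow_left₀ (norm_nonneg _) (hD i) 2
    simpa using this
  have hsum0 : 0 ≤ ∑ i, ‖gl_D u i p‖ ^ 2 := Finset.sum_nonneg fun i _ => by positivity
  have he0 : 0 ≤ gl_e ε u p := by unfold gl_e; positivity
  have he : gl_e ε u p ≤ Eb := by
    unfold gl_e
    rw [hEb]
    have h2 : (1 - ‖u p‖ ^ 2) ^ 2 ≤ (1 + C ^ 2) ^ 2 := by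
      have : ‖u p‖ ^ 2 ≤ C ^ 2 := pow_le_pow_left₀ (norm_nonneg _) hu 2
      refine sq_le_sq' ?_ ?_ <;> nlinarith [sq_nonneg ‖u p‖]
    gcongr
  have hcoord : ∀ i, |p.2 i - y i| ≤ r := by
    intro i
    have := PiLp.norm_apply_le (p.2 - y) i
    simpa using this
  have hw : ‖gl_w T y u p‖ ≤ W * (1 + r) := by
    unfold gl_w
    refine (norm_sub_le _ _).trans ?_
    have h3 : ‖∑ i, (p.2 i - y i) • gl_D u i p‖ ≤ N * (r * C) := by
      have : ‖∑ i, (p.2 i - y i) • gl_D u i p‖ ≤ ∑ _i : Fin N, r * C := by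
        refine norm_sum_le_of_le _ fun i _ => ?_
        rw [norm_smul]
        exact mul_le_mul (hcoord i) (hD i) (norm_nonneg _) hr0
      simpa using this
    rw [norm_smul, Real.norm_of_nonneg hinv0]
    have h4 : (2 * (T - p.1))⁻¹ * ‖∑ i, (p.2 i - y i) • gl_D u i p‖
        ≤ (2 * s0)⁻¹ * (N * (r * C)) := mul_le_mul hinv h3 (norm_nonneg _) (by positivity)
    have h5 : 0 ≤ (2 * s0)⁻¹ * (N * C) := by positivity
    rw [hW]
    nlinarith [mul_nonneg hC hr0]
  -- reduction
  have hred : ∀ z : ℝ, |z| ≤ (Eb + (Q + 2 * W ^ 2) + (2 * (W * C) + E2)) * (1 + r ^ 2) →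
      |z * gl_k T y p| ≤ (Eb + (Q + 2 * W ^ 2) + (2 * (W * C) + E2)) * c0
        * ((1 + r ^ 2) * Real.exp (-r ^ 2 / (4 * s1))) := by
    intro z hz
    rw [abs_mul, abs_of_nonneg hk0]
    refine (mul_le_mul hz hk hk0 (by positivity)).trans_eq (by ring)
  have hmono : ∀ {X : ℝ}, X ≤ (Eb + (Q + 2 * W ^ 2) + (2 * (W * C) + E2)) →
      X * (1 + r ^ 2) ≤ (Eb + (Q + 2 * W ^ 2) + (2 * (W * C) + E2)) * (1 + r ^ 2) :=
    fun h => mul_le_mul_of_nonneg_right h (by positivity)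
  have hr1 : r ≤ 1 + r ^ 2 := by nlinarith [sq_nonneg (r - 1)]
  refine ⟨hred _ ?_, ?_, fun i => ?_⟩
  · rw [abs_of_nonneg he0]
    refine le_trans ?_ (hmono (X := Eb) (by linarith [sq_nonneg W]))
    linarith [mul_nonneg hEb' (sq_nonneg r)]
  · rw [gl_G, mul_comm]
    refine hred _ (le_trans ?_ (hmono (X := Q + 2 * W ^ 2) (by linarith)))
    have h6 : (∑ j, ‖gl_D u j p‖ ^ 2) / (2 * (T - p.1)) ≤ Q := by
      rw [hQ]; gcongr
    have h7 : 0 ≤ (∑ j, ‖gl_D u j p‖ ^ 2) / (2 * (T - p.1)) := by positivity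
    have h8 : ‖gl_w T y u p‖ ^ 2 ≤ 2 * W ^ 2 * (1 + r ^ 2) := by
      refine (pow_le_pow_left₀ (norm_nonneg _) hw 2).trans ?_
      nlinarith [mul_nonneg (sq_nonneg W) (sq_nonneg (r - 1))]
    have h9 : 0 ≤ Q * r ^ 2 := by positivity
    have h10 : 0 ≤ ‖gl_w T y u p‖ ^ 2 := by positivity
    rw [abs_le]
    constructor <;> linarith [mul_nonneg (sq_nonneg W) (sq_nonneg r), sq_nonneg W]
  · rw [gl_Y, ← add_mul]
    refine hred _ (le_trans ?_ (hmono (X := 2 * (W * C) + E2) (by linarith [sq_nonneg W])))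
    refine (abs_add_le _ _).trans ?_
    rw [add_mul]
    refine add_le_add ?_ ?_
    · refine (abs_real_inner_le_norm _ _).trans ?_
      refine (mul_le_mul hw (hD i) (norm_nonneg _) (by positivity)).trans ?_
      nlinarith [mul_nonneg hWC (sq_nonneg (r - 1)), mul_nonneg hWC (sq_nonneg r)]
    · rw [div_eq_mul_inv, abs_mul, abs_mul, abs_of_nonneg he0, abs_of_nonneg hinv0, hE2]
      have : gl_e ε u p * |p.2 i - y i| * (2 * (T - p.1))⁻¹ ≤ Eb * (1 + r ^ 2) * (2 * s0)⁻¹ := by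
        have := (hcoord i).trans hr1
        gcongr
      linarith

end GLmain

/-- Euclidean monotonicity formula for the parabolic Ginzburg–Landau equation: if `u` is a
smooth bounded solution of `∂ₜu = Δu + ε⁻²u(1−|u|²)` on `ℝ^N × (0,T]`, then the Gaussian-weighted
energy `Z(R) = R²∫ e_ε(u(·,T−R²))·K(·,R²;y)` is differentiable on `(0,√T)` with
`Z′(R) = 2R∫ [V_ε(u) + Ξ]·K`, where `Ξ(x,t) = (T−t)|∂ₜu − ((x−y)·∇)u/(2(T−t))|²`. -/
theorem stmt_7 (N : ℕ) (hN : 0 < N) (ε T : ℝ) (hε : 0 < ε) (hT : 0 < T)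
    (y : EuclideanSpace ℝ (Fin N))
    (u : ℝ × EuclideanSpace ℝ (Fin N) → ℂ)
    (hsmooth : ContDiffOn ℝ (⊤ : ℕ∞) u (Set.Ioc 0 T ×ˢ (Set.univ : Set (EuclideanSpace ℝ (Fin N)))))
    (hpde : ∀ (x : EuclideanSpace ℝ (Fin N)), ∀ t ∈ Set.Ioc (0 : ℝ) T,
      deriv (fun s => u (s, x)) t =
        (∑ i, fderiv ℝ (fun z => fderiv ℝ (fun w => u (t, w)) z (EuclideanSpace.single i 1)) x
            (EuclideanSpace.single i 1))
          + ((ε ^ 2)⁻¹ * (1 - ‖u (t, x)‖ ^ 2)) • u (t, x))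
    (hbdd : ∀ δ ∈ Set.Ioo (0 : ℝ) T, ∃ C : ℝ,
      ∀ (x : EuclideanSpace ℝ (Fin N)), ∀ t ∈ Set.Icc δ T,
        ‖u (t, x)‖ ≤ C ∧ ‖deriv (fun s => u (s, x)) t‖ ≤ C ∧
        ‖fderiv ℝ (fun z => u (t, z)) x‖ ≤ C ∧
        ‖fderiv ℝ (fun z => fderiv ℝ (fun w => u (t, w)) z) x‖ ≤ C)
    (V e Ξ : ℝ × EuclideanSpace ℝ (Fin N) → ℝ)
    (hV : ∀ (t : ℝ) (x : EuclideanSpace ℝ (Fin N)),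
      V (t, x) = (1 - ‖u (t, x)‖ ^ 2) ^ 2 / (4 * ε ^ 2))
    (he : ∀ (t : ℝ) (x : EuclideanSpace ℝ (Fin N)),
      e (t, x) = (1 / 2) *
          (∑ i, ‖fderiv ℝ (fun z => u (t, z)) x (EuclideanSpace.single i 1)‖ ^ 2)
        + V (t, x))
    (hΞ : ∀ (t : ℝ) (x : EuclideanSpace ℝ (Fin N)),
      Ξ (t, x) = (T - t) *
        ‖deriv (fun s => u (s, x)) t -
          (2 * (T - t))⁻¹ •
            ∑ i, (x i - y i) •
              fderiv ℝ (fun z => u (t, z)) x (EuclideanSpace.single i 1)‖ ^ 2)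
    (K : EuclideanSpace ℝ (Fin N) → ℝ → ℝ)
    (hK : ∀ (x : EuclideanSpace ℝ (Fin N)) (s : ℝ),
      K x s = (4 * Real.pi * s) ^ (-(N : ℝ) / 2) * Real.exp (-‖x - y‖ ^ 2 / (4 * s)))
    (Z : ℝ → ℝ)
    (hZ : ∀ R : ℝ, Z R = R ^ 2 * ∫ x, e (T - R ^ 2, x) * K x (R ^ 2)) :
    ∀ R ∈ Set.Ioo (0 : ℝ) (Real.sqrt T),
      HasDerivAt Z (2 * R * ∫ x, (V (T - R ^ 2, x) + Ξ (T - R ^ 2, x)) * K x (R ^ 2)) R := by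
  intro R hR
  classical
  have hO := gl_open (N := N) (T := T)
  have hu : ContDiffOn ℝ 2 u (Set.Ioo 0 T ×ˢ (Set.univ : Set (EuclideanSpace ℝ (Fin N)))) :=
    (hsmooth.mono (Set.prod_mono Set.Ioo_subset_Ioc_self subset_rfl)).of_le (by
      exact WithTop.coe_le_coe.2 (le_top : (2 : ℕ∞) ≤ ⊤))
  have hdiff : ∀ t ∈ Set.Ioo 0 T, ∀ x, DifferentiableAt ℝ u (t, x) := fun t ht x =>
    (hu.contDiffAt (hO.mem_nhds ⟨ht, Set.mem_univ _⟩)).differentiableAt two_ne_zero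
  have hut : ∀ t ∈ Set.Ioo 0 T, ∀ x, deriv (fun s => u (s, x)) t = gl_ut u (t, x) :=
    fun t ht x => (gl_slice_t (hdiff t ht x)).deriv
  have hux : ∀ t ∈ Set.Ioo 0 T, ∀ x i, fderiv ℝ (fun z => u (t, z)) x (EuclideanSpace.single i 1)
      = gl_D u i (t, x) := by
    intro t ht x i
    rw [(gl_slice_x (hdiff t ht x)).fderiv]
    simp [gl_D]
  have hpde' : ∀ t ∈ Set.Ioo 0 T, ∀ x, gl_ut u (t, x)
      = ∑ i, fderiv ℝ (gl_D u i) (t, x) (0, EuclideanSpace.single i 1)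
        + ((ε ^ 2)⁻¹ * (1 - ‖u (t, x)‖ ^ 2)) • u (t, x) := by
    intro t ht x
    rw [← hut t ht x, hpde x t (Set.Ioo_subset_Ioc_self ht)]
    congr 1
    refine Finset.sum_congr rfl fun i _ => ?_
    simp_rw [hux t ht]
    have hd : DifferentiableAt ℝ (gl_D u i) (t, x) :=
      ((gl_cd_d hu _).contDiffAt (hO.mem_nhds ⟨ht, Set.mem_univ _⟩)).differentiableAt one_ne_zero
    rw [(gl_slice_x hd).fderiv]
    simp
  have he' : ∀ t ∈ Set.Ioo 0 T, ∀ x, e (t, x) = gl_e ε u (t, x) := by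
    intro t ht x
    rw [he, hV, gl_e]
    simp_rw [hux t ht]
  have hK' : ∀ t x, K x (T - t) = gl_k T y (t, x) := fun t x => hK x (T - t)
  -- parameters
  have hR0 : 0 < R := hR.1
  have hRT : R ^ 2 < T := (Real.lt_sqrt hR0.le).1 hR.2
  have hR2 : 0 < R ^ 2 := by positivity
  obtain ⟨t0, ht0⟩ : ∃ t0, t0 = T - R ^ 2 := ⟨_, rfl⟩
  have ht0' : t0 ∈ Set.Ioo 0 T := by rw [ht0]; constructor <;> linarith
  obtain ⟨a, ha⟩ : ∃ a, a = t0 / 2 := ⟨_, rfl⟩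
  obtain ⟨b, hb⟩ : ∃ b, b = (t0 + T) / 2 := ⟨_, rfl⟩
  have ha0 : 0 < a := by rw [ha]; linarith [ht0'.1]
  have hbT : b < T := by rw [hb]; linarith [ht0'.2]
  have htab : t0 ∈ Set.Ioo a b := by
    rw [ha, hb]; constructor <;> linarith [ht0'.1, ht0'.2]
  have haT : a < T := htab.1.trans (htab.2.trans hbT)
  have hsub : Set.Ioo a b ⊆ Set.Ioo 0 T := Set.Ioo_subset_Ioo ha0.le hbT.le
  have hsub' : Set.Ioo a b ×ˢ (Set.univ : Set (EuclideanSpace ℝ (Fin N)))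
      ⊆ Set.Ioo 0 T ×ˢ Set.univ := Set.prod_mono hsub subset_rfl
  obtain ⟨C, hC⟩ := hbdd a ⟨ha0, haT⟩
  have hC0 : 0 ≤ C := (norm_nonneg _).trans (hC y t0 ⟨htab.1.le, ht0'.2.le⟩).1
  obtain ⟨B, hB⟩ := gl_bounds ε T y u (C := C) (s0 := T - b) (s1 := T - a) hε
    (by linarith) hC0
  have hBB : ∀ t ∈ Set.Ioo a b, ∀ x, _ := fun t ht x => hB (t, x)
    (by simp only; linarith [ht.2]) (by simp only; linarith [ht.1])
    (hC x t ⟨ht.1.le, (hsub ht).2.le⟩).1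
    (by rw [← hut t (hsub ht) x]; exact (hC x t ⟨ht.1.le, (hsub ht).2.le⟩).2.1)
    (by
      intro i
      rw [← hux t (hsub ht) x i]
      refine (ContinuousLinearMap.le_opNorm _ _).trans ?_
      simpa using (hC x t ⟨ht.1.le, (hsub ht).2.le⟩).2.2.1)
  have hH := (gl_gauss y (c := 4 * (T - a)) (by linarith)).const_mul B
  have hcg : ContDiffOn ℝ 1 (fun p => gl_e ε u p * gl_k T y p)
      (Set.Ioo 0 T ×ˢ (Set.univ : Set (EuclideanSpace ℝ (Fin N)))) := (gl_cd_e hu).mul gl_cd_k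
  have main := gl_A volume (fun i : Fin N => EuclideanSpace.single i (1 : ℝ))
    (g := fun p => gl_e ε u p * gl_k T y p) (G := gl_G T y u) (Y := gl_Y ε T y u)
    (hcg.mono hsub') ((gl_cd_G hu).continuousOn.mono hsub')
    (fun i => (gl_cd_Y hu i).mono hsub') hH
    (fun t ht x => (hBB t ht x).1) (fun t ht x => (hBB t ht x).2.1)
    (fun i t ht x => (hBB t ht x).2.2 i)
    (fun t ht x => gl_identity hε hu (t, x) ⟨hsub ht, Set.mem_univ _⟩ (hpde' t (hsub ht) x)) htab
  have hig : Integrable (fun x => gl_e ε u (t0, x) * gl_k T y (t0, x)) :=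
    hH.mono' (gl_slice_cont ht0' hcg.continuousOn).aestronglyMeasurable
      (.of_forall fun x => (hBB t0 htab x).1)
  have hiG : Integrable (fun x => gl_G T y u (t0, x)) :=
    hH.mono' (gl_slice_cont ht0' (gl_cd_G hu).continuousOn).aestronglyMeasurable
      (.of_forall fun x => (hBB t0 htab x).2.1)
  have hin : HasDerivAt (fun R : ℝ => T - R ^ 2) (-(2 * R)) R := by
    simpa using ((hasDerivAt_id R).fun_pow 2).const_sub T
  rw [ht0] at main
  have hcomp := HasDerivAt.comp R main hin
  have hprod := ((hasDerivAt_id R).fun_pow 2).fun_mul hcomp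
  refine HasDerivAt.congr_deriv (hprod.congr_of_eventuallyEq ?_) ?_
  · filter_upwards [isOpen_Ioo.mem_nhds hR] with ρ hρ
    have h1 : ρ ^ 2 < T := (Real.lt_sqrt hρ.1.le).1 hρ.2
    have h2 : 0 < ρ ^ 2 := pow_pos hρ.1 2
    have h3 : T - ρ ^ 2 ∈ Set.Ioo 0 T := by constructor <;> linarith
    rw [hZ]
    simp only [id, Function.comp]
    congr 1
    refine integral_congr_ae (.of_forall fun x => ?_)
    simp only
    rw [he' _ h3 x, ← hK', sub_sub_cancel]
  · have e1 : ∀ x, (V (T - R ^ 2, x) + Ξ (T - R ^ 2, x)) * K x (R ^ 2)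
        = gl_e ε u (t0, x) * gl_k T y (t0, x) - R ^ 2 * gl_G T y u (t0, x) := by
      intro x
      have hKx : K x (R ^ 2) = gl_k T y (t0, x) := by
        rw [← hK', ht0, sub_sub_cancel]
      rw [hKx, hV, hΞ, ← ht0]
      simp_rw [hux t0 ht0', hut t0 ht0']
      have hw : gl_ut u (t0, x) - (2 * (T - t0))⁻¹ • ∑ i, (x i - y i) • gl_D u i (t0, x)
          = gl_w T y u (t0, x) := rfl
      rw [hw, gl_e, gl_G]
      have hs : T - t0 = R ^ 2 := by rw [ht0]; ring
      simp only [hs]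
      field_simp
      ring
    simp_rw [e1]
    rw [integral_sub hig (hiG.const_mul _), integral_const_mul, ht0]
    simp only [id, Function.comp]
    norm_num
    ring
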